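/- Let Q be a Dynkin quiver and M a brick in P(Q)-mod. Then Ext¹(M,M) = 0 and the dimension vector of M is a root, i.e. (dim M, dim M) = 2. -/

import Mathlib

open CategoryTheory Limits Pretriangulated

universe v u

namespace GreenSeqPaper



/-- A finite quiver without loops: finitely many vertices `V` and arrows `A`,
with source and target maps, and no arrow from a vertex to itself. -/
structure LooplessQuiver where
  V : Type
  A : Type
  [fintypeV : Fintype V]
  [decEqV : DecidableEq V]
  [fintypeA : Fintype A]
  src : A → V
  tgt : A → V
  no_loops : ∀ a, src a ≠ tgt a

attribute [instance] LooplessQuiver.fintypeV LooplessQuiver.decEqV LooplessQuiver.fintypeA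

namespace LooplessQuiver

variable (Q : LooplessQuiver)

/-- The arrows of the double quiver `Q̄`: an arrow `a : i ⟶ j` of `Q` (left) together
with a reversed arrow `a* : j ⟶ i` (right). -/
abbrev DArrow := Q.A ⊕ Q.A

/-- Source of an arrow of the double quiver. -/
def dsrc : Q.DArrow → Q.V
  | .inl a => Q.src a
  | .inr a => Q.tgt a

/-- Target of an arrow of the double quiver. -/
def dtgt : Q.DArrow → Q.V
  | .inl a => Q.tgt a
  | .inr a => Q.src a

/-- Generators of the path algebra of the double quiver: one idempotent `e i` for each
vertex `i` and one generator `x a` for each arrow `a` of the double quiver. -/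
abbrev Gen := Q.V ⊕ Q.DArrow

/-- The vertex idempotent `e i` in the free algebra. -/
noncomputable def e (i : Q.V) : FreeAlgebra ℂ Q.Gen := FreeAlgebra.ι ℂ (Sum.inl i)

/-- The arrow generator `x a` in the free algebra. -/
noncomputable def x (a : Q.DArrow) : FreeAlgebra ℂ Q.Gen := FreeAlgebra.ι ℂ (Sum.inr a)

/-- The relations presenting the preprojective algebra `P(Q) = ℂQ̄/(c)`:
the path-algebra relations of the double quiver `Q̄` (orthogonal vertex idempotents
summing to `1`, compatibility of arrows with their endpoints), together with the
preprojective relation `c = Σ_{a ∈ Q₁} (a a* - a* a) = 0`. -/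
inductive Rel : FreeAlgebra ℂ Q.Gen → FreeAlgebra ℂ Q.Gen → Prop
  | vertex_mul (i j : Q.V) : Rel (Q.e i * Q.e j) (if i = j then Q.e i else 0)
  | vertex_sum : Rel (∑ i : Q.V, Q.e i) 1
  | arrow_left (a : Q.DArrow) : Rel (Q.e (Q.dtgt a) * Q.x a) (Q.x a)
  | arrow_right (a : Q.DArrow) : Rel (Q.x a * Q.e (Q.dsrc a)) (Q.x a)
  | preprojective :
      Rel (∑ a : Q.A, (Q.x (Sum.inl a) * Q.x (Sum.inr a) - Q.x (Sum.inr a) * Q.x (Sum.inl a))) 0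

/-- The preprojective algebra `P(Q)` of the quiver `Q`. -/
abbrev Preproj := RingQuot Q.Rel

/-- The image of the vertex idempotent `e i` in `P(Q)`. -/
noncomputable def pe (i : Q.V) : Q.Preproj := RingQuot.mkAlgHom ℂ Q.Rel (Q.e i)

/-- The image of the arrow generator `x a` in `P(Q)`. -/
noncomputable def px (a : Q.DArrow) : Q.Preproj := RingQuot.mkAlgHom ℂ Q.Rel (Q.x a)

/-- The symmetric bilinear form `(x, y) = 2 Σ_i x_i y_i - Σ_{a : i → j ∈ Q̄₁} x_i y_j`
on the root lattice `ℤQ₀` (the sum runs over the arrows of the double quiver). -/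
def form (v w : Q.V → ℤ) : ℤ :=
  2 * ∑ i : Q.V, v i * w i -
    ∑ a : Q.A, (v (Q.src a) * w (Q.tgt a) + v (Q.tgt a) * w (Q.src a))

/-- `Q` is of Dynkin type, i.e. its underlying graph is a disjoint union of ADE Dynkin
diagrams; equivalently, the symmetric bilinear form of `Q` is positive definite. -/
def IsDynkin : Prop := ∀ v : Q.V → ℤ, v ≠ 0 → 0 < Q.form v v

end LooplessQuiver

section Modules

open ModuleCat

variable (Q : LooplessQuiver)

-- the scoped instances `ModuleCat.moduleOfAlgebraModule` and
-- `ModuleCat.isScalarTower_of_algebra_moduleCat` give each `P(Q)`-module its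
-- canonical `ℂ`-vector space structure
attribute [local instance] ModuleCat.moduleOfAlgebraModule
  ModuleCat.isScalarTower_of_algebra_moduleCat

/-- A `P(Q)`-module is finite-dimensional if it is so as a `ℂ`-vector space. -/
def LooplessQuiver.FinDim (M : ModuleCat.{0} Q.Preproj) : Prop := FiniteDimensional ℂ M

/-- A `P(Q)`-module is nilpotent if all sufficiently long products of arrows act by zero;
equivalently, all its composition factors are the vertex simples `S₁, …, Sₙ`. -/
def LooplessQuiver.IsNilpotentMod (M : ModuleCat.{0} Q.Preproj) : Prop :=
  ∃ N : ℕ, ∀ l : List Q.DArrow, l.length = N → ∀ m : M, (l.map Q.px).prod • m = 0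

/-- The dimension of the vector space `eᵢ M` attached to the vertex `i` by the
`P(Q)`-module `M` (viewed as a representation of the double quiver). -/
noncomputable def LooplessQuiver.dimAt (M : ModuleCat.{0} Q.Preproj) (i : Q.V) : ℕ :=
  Module.finrank ℂ (Submodule.span ℂ (Set.range fun m : M => Q.pe i • m))

/-- The dimension vector of a `P(Q)`-module, as an element of the root lattice `ℤQ₀`. -/
noncomputable def LooplessQuiver.dimVec (M : ModuleCat.{0} Q.Preproj) : Q.V → ℤ :=
  fun i => (Q.dimAt M i : ℤ)

/-- A brick: a module `M` with `Hom(M, M) = ℂ`, i.e. `M` is nonzero and every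
endomorphism of `M` is multiplication by a scalar. -/
def LooplessQuiver.IsBrick (M : ModuleCat.{0} Q.Preproj) : Prop :=
  (∃ m : M, m ≠ 0) ∧
    ∀ f : M ⟶ M, ∃ c : ℂ, ∀ m : M, f m = algebraMap ℂ Q.Preproj c • m

/-- `Ext¹(M, N) = 0` for `P(Q)`-modules. -/
def LooplessQuiver.Ext1Vanishes (M N : ModuleCat.{0} Q.Preproj) : Prop :=
  Subsingleton (((Ext ℂ (ModuleCat.{0} Q.Preproj) 1).obj (Opposite.op M)).obj N)

/-- A module is rigid if `Ext¹(M, M) = 0`. -/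
def LooplessQuiver.IsRigid (M : ModuleCat.{0} Q.Preproj) : Prop := Q.Ext1Vanishes M M

/-- `dim_ℂ Extⁿ(M, N)` for `P(Q)`-modules. -/
noncomputable def LooplessQuiver.extDim (n : ℕ) (M N : ModuleCat.{0} Q.Preproj) : ℕ :=
  Module.finrank ℂ (((Ext ℂ (ModuleCat.{0} Q.Preproj) n).obj (Opposite.op M)).obj N)

/-- `dim_ℂ Hom(M, N)` for `P(Q)`-modules. -/
noncomputable def LooplessQuiver.homDim (M N : ModuleCat.{0} Q.Preproj) : ℕ :=
  Module.finrank ℂ (M ⟶ N)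

end Modules


section DoubleQuiverRepresentation

variable {K I A : Type*} [Field K] [DecidableEq I] {s t : A → I}
  {V : I → Type*} [∀ i, AddCommGroup (V i)] [∀ i, Module K (V i)]

/-- The infinitesimal change-of-basis action at a representation `(X, Y)` of a double quiver:
the first map of the deformation complex of `(X, Y)`. -/
def repDerivation (X : ∀ a, V (s a) →ₗ[K] V (t a)) (Y : ∀ a, V (t a) →ₗ[K] V (s a)) :
    (∀ i, Module.End K (V i)) →ₗ[K]
      (∀ a, V (s a) →ₗ[K] V (t a)) × (∀ a, V (t a) →ₗ[K] V (s a)) where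
  toFun f := (fun a => f (t a) ∘ₗ X a - X a ∘ₗ f (s a), fun a => f (s a) ∘ₗ Y a - Y a ∘ₗ f (t a))
  map_add' f g := by
    ext a v <;> simp <;> abel
  map_smul' c f := by
    ext a v <;> simp [smul_sub]

/-- The moment map `∑ a, (X a Y a - Y a X a)` of a representation of a double quiver. -/
def momentMap [Fintype A]
    (X : ∀ a, V (s a) →ₗ[K] V (t a)) (Y : ∀ a, V (t a) →ₗ[K] V (s a)) :
    ∀ i, Module.End K (V i) :=
  ∑ a, (Pi.single (t a) (X a ∘ₗ Y a) - Pi.single (s a) (Y a ∘ₗ X a))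

/-- The derivative of the moment map at a representation `(X, Y)` of a double quiver:
the second map of the deformation complex of `(X, Y)`. -/
def momentMapDeriv [Fintype A]
    (X : ∀ a, V (s a) →ₗ[K] V (t a)) (Y : ∀ a, V (t a) →ₗ[K] V (s a)) :
    (∀ a, V (s a) →ₗ[K] V (t a)) × (∀ a, V (t a) →ₗ[K] V (s a)) →ₗ[K]
      (∀ i, Module.End K (V i)) where
  toFun c := ∑ a, (Pi.single (t a) (c.1 a ∘ₗ Y a + X a ∘ₗ c.2 a) -
    Pi.single (s a) (c.2 a ∘ₗ X a + Y a ∘ₗ c.1 a))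
  map_add' c c' := by
    rw [← Finset.sum_add_distrib]
    refine Finset.sum_congr rfl fun a _ => ?_
    simp only [Prod.fst_add, Prod.snd_add, Pi.add_apply, LinearMap.add_comp, LinearMap.comp_add,
      Pi.single_add]
    abel
  map_smul' r c := by
    rw [RingHom.id_apply, Finset.smul_sum]
    refine Finset.sum_congr rfl fun a _ => ?_
    simp only [Prod.smul_fst, Prod.smul_snd, Pi.smul_apply, LinearMap.smul_comp,
      LinearMap.comp_smul, ← smul_add, Pi.single_smul, smul_sub]

theorem momentMapDeriv_apply [Fintype A]
    (X : ∀ a, V (s a) →ₗ[K] V (t a)) (Y : ∀ a, V (t a) →ₗ[K] V (s a))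
    (c : (∀ a, V (s a) →ₗ[K] V (t a)) × (∀ a, V (t a) →ₗ[K] V (s a))) :
    momentMapDeriv X Y c = ∑ a, (Pi.single (t a) (c.1 a ∘ₗ Y a + X a ∘ₗ c.2 a) -
      Pi.single (s a) (c.2 a ∘ₗ X a + Y a ∘ₗ c.1 a)) := rfl

theorem momentMapDeriv_repDerivation [Fintype A]
    (X : ∀ a, V (s a) →ₗ[K] V (t a)) (Y : ∀ a, V (t a) →ₗ[K] V (s a))
    (f : ∀ i, Module.End K (V i)) :
    momentMapDeriv X Y (repDerivation X Y f) = f * momentMap X Y - momentMap X Y * f := by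
  have hl (i : I) (g : Module.End K (V i)) :
      f * Pi.single i g = Pi.single i (f i ∘ₗ g) := by
    ext j : 1
    obtain rfl | h := eq_or_ne j i
    · simp [Module.End.mul_eq_comp]
    · simp [h]
  have hr (i : I) (g : Module.End K (V i)) :
      Pi.single i g * f = Pi.single i (g ∘ₗ f i) := by
    ext j : 1
    obtain rfl | h := eq_or_ne j i
    · simp [Module.End.mul_eq_comp]
    · simp [h]
  simp only [momentMap, Finset.mul_sum, Finset.sum_mul, mul_sub, sub_mul, hl, hr,
    ← Finset.sum_sub_distrib]
  refine Finset.sum_congr rfl fun a _ => ?_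
  simp only [repDerivation, LinearMap.coe_mk, AddHom.coe_mk, LinearMap.sub_comp, LinearMap.comp_sub,
    LinearMap.comp_assoc, Pi.single_add, Pi.single_sub]
  abel

variable [Fintype I] [Fintype A]

theorem sum_trace_mul_single (f : ∀ i, Module.End K (V i)) (i : I) (g : Module.End K (V i)) :
    ∑ j, LinearMap.trace K (V j) (f j * (Pi.single i g : ∀ i, Module.End K (V i)) j) =
      LinearMap.trace K (V i) (f i * g) := by
  rw [Finset.sum_eq_single i (fun j _ hj => by simp [hj]) (by simp)]
  simp

variable [∀ i, FiniteDimensional K (V i)]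

/-- The two maps of the deformation complex are adjoint for the trace pairings. -/
theorem sum_trace_mul_momentMapDeriv
    (X : ∀ a, V (s a) →ₗ[K] V (t a)) (Y : ∀ a, V (t a) →ₗ[K] V (s a))
    (f : ∀ i, Module.End K (V i))
    (c : (∀ a, V (s a) →ₗ[K] V (t a)) × (∀ a, V (t a) →ₗ[K] V (s a))) :
    ∑ i, LinearMap.trace K (V i) (f i * momentMapDeriv X Y c i) =
      ∑ a, (LinearMap.trace K (V (t a)) ((repDerivation X Y f).1 a ∘ₗ c.2 a) -
        LinearMap.trace K (V (s a)) ((repDerivation X Y f).2 a ∘ₗ c.1 a)) := by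
  have h : ∀ i, LinearMap.trace K (V i) (f i * momentMapDeriv X Y c i) = ∑ a,
      (LinearMap.trace K (V i) (f i *
          (Pi.single (t a) (c.1 a ∘ₗ Y a + X a ∘ₗ c.2 a) : ∀ i, Module.End K (V i)) i) -
        LinearMap.trace K (V i) (f i *
          (Pi.single (s a) (c.2 a ∘ₗ X a + Y a ∘ₗ c.1 a) : ∀ i, Module.End K (V i)) i)) := by
    intro i
    simp only [momentMapDeriv_apply, Finset.sum_apply, Pi.sub_apply,
      Finset.mul_sum, mul_sub, map_sum, map_sub]
  simp only [h]
  rw [Finset.sum_comm]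
  refine Finset.sum_congr rfl fun a _ => ?_
  rw [Finset.sum_sub_distrib, sum_trace_mul_single, sum_trace_mul_single]
  simp only [repDerivation, LinearMap.coe_mk, AddHom.coe_mk, LinearMap.sub_comp, map_sub,
    mul_add, map_add, Module.End.mul_eq_comp]
  have h1 := LinearMap.trace_comp_comm' (R := K) (f (t a) ∘ₗ c.1 a) (Y a)
  have h2 := LinearMap.trace_comp_comm' (R := K) (f (s a) ∘ₗ c.2 a) (X a)
  simp only [LinearMap.comp_assoc] at h1 h2 ⊢
  rw [h1, h2]
  ring

theorem LinearMap.eq_zero_of_trace_comp_eq_zero {U W : Type*} [AddCommGroup U] [Module K U]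
    [FiniteDimensional K U] [AddCommGroup W] [Module K W] [FiniteDimensional K W]
    (f : U →ₗ[K] W) (h : ∀ g : W →ₗ[K] U, LinearMap.trace K W (f ∘ₗ g) = 0) : f = 0 := by
  ext u
  rw [LinearMap.zero_apply, ← Module.forall_dual_apply_eq_zero_iff K]
  intro φ
  have := h (φ.smulRight u)
  rwa [show f ∘ₗ φ.smulRight u = φ.smulRight (f u) by ext; simp, LinearMap.trace_smulRight] at this

theorem finrank_range_repDerivation_le
    (X : ∀ a, V (s a) →ₗ[K] V (t a)) (Y : ∀ a, V (t a) →ₗ[K] V (s a)) :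
    Module.finrank K (LinearMap.range (repDerivation X Y)) ≤
      Module.finrank K (LinearMap.range (momentMapDeriv X Y)) := by
  classical
  let B : (∀ i, Module.End K (V i)) →ₗ[K] Module.Dual K (∀ i, Module.End K (V i)) :=
    ∑ i, ((LinearMap.mul K (Module.End K (V i))).compr₂ (LinearMap.trace K (V i))).compl₁₂
      (LinearMap.proj i) (LinearMap.proj i)
  have hB (f g) : B f g = ∑ i, LinearMap.trace K (V i) (f i * g i) := by
    simp [B, LinearMap.sum_apply]
  have hker : LinearMap.ker ((momentMapDeriv X Y).dualMap ∘ₗ B) ≤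
      LinearMap.ker (repDerivation X Y) := by
    intro f hf
    have hf' (c : (∀ a, V (s a) →ₗ[K] V (t a)) × (∀ a, V (t a) →ₗ[K] V (s a))) :
        ∑ a, (LinearMap.trace K (V (t a)) ((repDerivation X Y f).1 a ∘ₗ c.2 a) -
        LinearMap.trace K (V (s a)) ((repDerivation X Y f).2 a ∘ₗ c.1 a)) = 0 := by
      rw [← sum_trace_mul_momentMapDeriv, ← hB]
      exact LinearMap.congr_fun (LinearMap.mem_ker.1 hf) c
    rw [LinearMap.mem_ker]
    refine Prod.ext (funext fun a => ?_) (funext fun a => ?_)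
    · refine LinearMap.eq_zero_of_trace_comp_eq_zero _ fun g => ?_
      have := hf' (0, Pi.single a g)
      simp only [Pi.zero_apply, LinearMap.comp_zero, map_zero, sub_zero] at this
      rw [Finset.sum_eq_single a (fun b _ hb => by simp [hb]) (by simp)] at this
      simpa using this
    · refine LinearMap.eq_zero_of_trace_comp_eq_zero _ fun g => ?_
      have := hf' (Pi.single a g, 0)
      simp only [Pi.zero_apply, LinearMap.comp_zero, map_zero, zero_sub] at this
      rw [Finset.sum_eq_single a (fun b _ hb => by simp [hb]) (by simp)] at this
      simpa using this
  have h1 := LinearMap.finrank_range_add_finrank_ker (repDerivation X Y)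
  have h2 := LinearMap.finrank_range_add_finrank_ker ((momentMapDeriv X Y).dualMap ∘ₗ B)
  have h3 := Submodule.finrank_mono hker
  have h4 := Submodule.finrank_mono (LinearMap.range_comp_le_range B (momentMapDeriv X Y).dualMap)
  have h5 := LinearMap.finrank_range_dualMap_eq_finrank_range (momentMapDeriv X Y)
  omega

/-- If a representation of the preprojective relation has only scalar endomorphisms and its
dimension vector has positive norm, then the dimension vector is a root and the deformation complex
is exact in the middle. -/
theorem exists_repDerivation_eq_of_momentMapDeriv_eq_zero
    (X : ∀ a, V (s a) →ₗ[K] V (t a)) (Y : ∀ a, V (t a) →ₗ[K] V (s a))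
    (hμ : momentMap X Y = 0)
    (hbrick : ∀ f, repDerivation X Y f = 0 → ∃ c : K, f = c • 1)
    (hpos : ∑ a, Module.finrank K (V (s a)) * Module.finrank K (V (t a)) <
      ∑ i, Module.finrank K (V i) ^ 2) :
    (∑ i, Module.finrank K (V i) ^ 2 =
      ∑ a, Module.finrank K (V (s a)) * Module.finrank K (V (t a)) + 1) ∧
    ∀ c, momentMapDeriv X Y c = 0 → ∃ f, repDerivation X Y f = c := by
  have hle : LinearMap.range (repDerivation X Y) ≤ LinearMap.ker (momentMapDeriv X Y) := by
    rintro _ ⟨f, rfl⟩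
    rw [LinearMap.mem_ker, momentMapDeriv_repDerivation, hμ, mul_zero, zero_mul, sub_zero]
  have hker : Module.finrank K (LinearMap.ker (repDerivation X Y)) ≤ 1 := by
    refine (Submodule.finrank_mono (t := Submodule.span K {1}) fun f hf => ?_).trans
      ((finrank_span_le_card _).trans (by simp))
    obtain ⟨c, rfl⟩ := hbrick f hf
    exact Submodule.smul_mem _ _ (Submodule.mem_span_singleton_self _)
  have h0 : Module.finrank K (∀ i, Module.End K (V i)) = ∑ i, Module.finrank K (V i) ^ 2 := by
    rw [Module.finrank_pi_fintype]
    exact Finset.sum_congr rfl fun i _ => by rw [Module.finrank_linearMap, sq]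
  have h1 : Module.finrank K ((∀ a, V (s a) →ₗ[K] V (t a)) × (∀ a, V (t a) →ₗ[K] V (s a))) =
      2 * ∑ a, Module.finrank K (V (s a)) * Module.finrank K (V (t a)) := by
    rw [Module.finrank_prod, Module.finrank_pi_fintype, Module.finrank_pi_fintype, two_mul]
    congr 1 <;> refine Finset.sum_congr rfl fun i _ => ?_ <;> rw [Module.finrank_linearMap]
    rw [mul_comm]
  have h2 := LinearMap.finrank_range_add_finrank_ker (repDerivation X Y)
  have h3 := LinearMap.finrank_range_add_finrank_ker (momentMapDeriv X Y)
  have h4 := finrank_range_repDerivation_le X Y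
  have h5 := Submodule.finrank_mono hle
  have heq : Module.finrank K (LinearMap.range (repDerivation X Y)) =
      Module.finrank K (LinearMap.ker (momentMapDeriv X Y)) := by omega
  refine ⟨by omega, fun c hc => ?_⟩
  rw [← LinearMap.mem_ker, ← Submodule.eq_of_le_of_finrank_eq hle heq] at hc
  exact hc

end DoubleQuiverRepresentation

namespace LooplessQuiver

section Relations

variable (Q : LooplessQuiver)

theorem pe_mul_pe (i j : Q.V) : Q.pe i * Q.pe j = if i = j then Q.pe i else 0 := by
  have := RingQuot.mkAlgHom_rel ℂ (Rel.vertex_mul (Q := Q) i j)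
  rw [map_mul] at this
  rw [pe, pe, this]
  split_ifs <;> simp

theorem sum_pe : ∑ i, Q.pe i = 1 := by
  have := RingQuot.mkAlgHom_rel ℂ (Rel.vertex_sum (Q := Q))
  rwa [map_sum, map_one] at this

theorem pe_mul_px (a : Q.DArrow) : Q.pe (Q.dtgt a) * Q.px a = Q.px a := by
  have := RingQuot.mkAlgHom_rel ℂ (Rel.arrow_left (Q := Q) a)
  rwa [map_mul] at this

theorem px_mul_pe (a : Q.DArrow) : Q.px a * Q.pe (Q.dsrc a) = Q.px a := by
  have := RingQuot.mkAlgHom_rel ℂ (Rel.arrow_right (Q := Q) a)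
  rwa [map_mul] at this

theorem sum_px_mul_px :
    ∑ a : Q.A, (Q.px (.inl a) * Q.px (.inr a) - Q.px (.inr a) * Q.px (.inl a)) = 0 := by
  have := RingQuot.mkAlgHom_rel ℂ (Rel.preprojective (Q := Q))
  simpa only [map_sum, map_sub, map_mul, map_zero] using! this

variable {Q} in
/-- Induction principle for the preprojective algebra, from its generators. -/
theorem preproj_induction {p : Q.Preproj → Prop}
    (halg : ∀ c : ℂ, p (algebraMap ℂ Q.Preproj c)) (hpe : ∀ i, p (Q.pe i)) (hpx : ∀ a, p (Q.px a))
    (hmul : ∀ r r', p r → p r' → p (r * r')) (hadd : ∀ r r', p r → p r' → p (r + r'))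
    (r : Q.Preproj) : p r := by
  obtain ⟨w, rfl⟩ := RingQuot.mkAlgHom_surjective ℂ Q.Rel r
  induction w using FreeAlgebra.induction with
  | grade0 c => simpa using halg c
  | grade1 w =>
    cases w with
    | inl i => exact hpe i
    | inr a => exact hpx a
  | mul a b ha hb => simpa using hmul _ _ ha hb
  | add a b ha hb => simpa using hadd _ _ ha hb

end Relations

section Modules

variable (Q : LooplessQuiver) (M : Type*) [AddCommGroup M] [Module ℂ M] [Module Q.Preproj M]
  [IsScalarTower ℂ Q.Preproj M]

/-- The action of the preprojective algebra on a module, by `ℂ`-linear endomorphisms. -/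
noncomputable abbrev act : Q.Preproj →ₐ[ℂ] Module.End ℂ M := Algebra.lsmul ℂ ℂ M

/-- The vector space at the vertex `i` of the representation attached to a module. -/
noncomputable abbrev vertexSpace (i : Q.V) : Submodule ℂ M := LinearMap.range (Q.act M (Q.pe i))

variable {M}

/-- The projection of a module onto the vector space at the vertex `i`. -/
noncomputable abbrev vertexProj (i : Q.V) : M →ₗ[ℂ] Q.vertexSpace M i :=
  (Q.act M (Q.pe i)).rangeRestrict

/-- The block from the vertex `i` to the vertex `j` of an endomorphism. -/
noncomputable def block (φ : Module.End ℂ M) (i j : Q.V) :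
    Q.vertexSpace M i →ₗ[ℂ] Q.vertexSpace M j :=
  Q.vertexProj j ∘ₗ φ ∘ₗ (Q.vertexSpace M i).subtype

@[simp] theorem coe_vertexProj (i : Q.V) (m : M) : (Q.vertexProj i m : M) = Q.pe i • m := rfl

@[simp] theorem coe_block (φ : Module.End ℂ M) (i j : Q.V) (v : Q.vertexSpace M i) :
    (Q.block φ i j v : M) = Q.pe j • φ v := rfl

theorem pe_smul_coe (i : Q.V) (v : Q.vertexSpace M i) : Q.pe i • (v : M) = v := by
  obtain ⟨_, m, rfl⟩ := v
  simp [smul_smul, pe_mul_pe]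

theorem pe_smul_coe_of_ne {i j : Q.V} (h : j ≠ i) (v : Q.vertexSpace M i) :
    Q.pe j • (v : M) = 0 := by
  obtain ⟨_, m, rfl⟩ := v
  simp [smul_smul, pe_mul_pe, h]

/-- The block-diagonal endomorphism with given diagonal blocks. -/
noncomputable def blockDiag (f : ∀ i, Module.End ℂ (Q.vertexSpace M i)) : Module.End ℂ M :=
  ∑ i, (Q.vertexSpace M i).subtype ∘ₗ f i ∘ₗ Q.vertexProj i

theorem blockDiag_apply (f : ∀ i, Module.End ℂ (Q.vertexSpace M i)) (m : M) :
    Q.blockDiag f m = ∑ i, (f i (Q.vertexProj i m) : M) := by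
  simp [blockDiag, LinearMap.sum_apply]

theorem pe_smul_blockDiag (f : ∀ i, Module.End ℂ (Q.vertexSpace M i)) (i : Q.V) (m : M) :
    Q.pe i • Q.blockDiag f m = f i (Q.vertexProj i m) := by
  rw [blockDiag_apply, Finset.smul_sum, Finset.sum_eq_single i
    (fun j _ hj => Q.pe_smul_coe_of_ne hj.symm _) (by simp), pe_smul_coe]

theorem blockDiag_pe_smul (f : ∀ i, Module.End ℂ (Q.vertexSpace M i)) (i : Q.V) (m : M) :
    Q.blockDiag f (Q.pe i • m) = f i (Q.vertexProj i m) := by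
  rw [blockDiag_apply, Finset.sum_eq_single i _ (by simp)]
  · congr 2
    exact Subtype.ext (Q.pe_smul_coe i (Q.vertexProj i m))
  · intro j _ hj
    rw [show Q.vertexProj j (Q.pe i • m) = 0 from
      Subtype.ext (Q.pe_smul_coe_of_ne hj (Q.vertexProj i m)), map_zero, ZeroMemClass.coe_zero]

theorem blockDiag_injective :
    Function.Injective (Q.blockDiag : (∀ i, Module.End ℂ (Q.vertexSpace M i)) → _) := by
  intro f g h
  ext i ⟨_, m, rfl⟩
  have := congrArg (fun φ : Module.End ℂ M => Q.pe i • φ m) h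
  simpa only [pe_smul_blockDiag] using! this

theorem blockDiag_single_apply (i : Q.V) (g : Module.End ℂ (Q.vertexSpace M i)) (m : M) :
    Q.blockDiag (Pi.single i g) m = g (Q.vertexProj i m) := by
  rw [blockDiag_apply, Finset.sum_eq_single i (fun j _ hj => by simp [hj]) (by simp)]
  simp

theorem blockDiag_sum_single_sub {A : Type*} [Fintype A] (s t : A → Q.V)
    (g : ∀ a, Module.End ℂ (Q.vertexSpace M (t a))) (h : ∀ a, Module.End ℂ (Q.vertexSpace M (s a)))
    (m : M) :
    Q.blockDiag (∑ a, (Pi.single (t a) (g a) - Pi.single (s a) (h a))) m =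
      ∑ a, ((g a (Q.vertexProj (t a) m) : M) - h a (Q.vertexProj (s a) m)) := by
  let L : (∀ i, Module.End ℂ (Q.vertexSpace M i)) →+ M :=
    { toFun := fun f => Q.blockDiag f m
      map_zero' := by simp [blockDiag_apply]
      map_add' := fun f g => by simp [blockDiag_apply, Finset.sum_add_distrib] }
  change L _ = _
  rw [map_sum]
  refine Finset.sum_congr rfl fun a _ => ?_
  rw [map_sub]
  exact congrArg₂ _ (Q.blockDiag_single_apply _ _ m) (Q.blockDiag_single_apply _ _ m)

variable (M)

/-- The map along an arrow of `Q` of the representation attached to a module. -/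
noncomputable def arrowMap (a : Q.A) : Q.vertexSpace M (Q.src a) →ₗ[ℂ] Q.vertexSpace M (Q.tgt a) :=
  Q.block (Q.act M (Q.px (.inl a))) _ _

/-- The map along a reversed arrow of `Q` of the representation attached to a module. -/
noncomputable def arrowMapStar (a : Q.A) :
    Q.vertexSpace M (Q.tgt a) →ₗ[ℂ] Q.vertexSpace M (Q.src a) :=
  Q.block (Q.act M (Q.px (.inr a))) _ _

/-- The first map of the deformation complex of the representation attached to a module. -/
noncomputable abbrev arrowDeriv :=
  repDerivation (V := fun i => Q.vertexSpace M i) (Q.arrowMap M) (Q.arrowMapStar M)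

/-- The second map of the deformation complex of the representation attached to a module. -/
noncomputable abbrev momentDeriv :=
  momentMapDeriv (V := fun i => Q.vertexSpace M i) (Q.arrowMap M) (Q.arrowMapStar M)

variable {M}

theorem pe_smul_px_smul (a : Q.DArrow) (m : M) : Q.pe (Q.dtgt a) • Q.px a • m = Q.px a • m := by
  rw [smul_smul, pe_mul_px]

theorem px_smul_pe_smul (a : Q.DArrow) (m : M) : Q.px a • Q.pe (Q.dsrc a) • m = Q.px a • m := by
  rw [smul_smul, px_mul_pe]

@[simp] theorem coe_arrowMap (a : Q.A) (v : Q.vertexSpace M (Q.src a)) :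
    (Q.arrowMap M a v : M) = Q.px (.inl a) • (v : M) := Q.pe_smul_px_smul (.inl a) _

@[simp] theorem coe_arrowMapStar (a : Q.A) (v : Q.vertexSpace M (Q.tgt a)) :
    (Q.arrowMapStar M a v : M) = Q.px (.inr a) • (v : M) := Q.pe_smul_px_smul (.inr a) _

variable (M) in
theorem momentMap_arrowMap :
    momentMap (V := fun i => Q.vertexSpace M i) (Q.arrowMap M) (Q.arrowMapStar M) = 0 := by
  refine Q.blockDiag_injective (LinearMap.ext fun m => ?_)
  rw [momentMap, blockDiag_sum_single_sub]
  have h : ∀ a : Q.A, (((Q.arrowMap M a ∘ₗ Q.arrowMapStar M a) (Q.vertexProj (Q.tgt a) m) : M) -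
      (Q.arrowMapStar M a ∘ₗ Q.arrowMap M a) (Q.vertexProj (Q.src a) m)) =
      (Q.px (.inl a) * Q.px (.inr a) - Q.px (.inr a) * Q.px (.inl a)) • m := by
    intro a
    have h1 := Q.px_smul_pe_smul (.inl a) m
    have h2 := Q.px_smul_pe_smul (.inr a) m
    simp only [dsrc] at h1 h2
    simp [sub_smul, mul_smul, h1, h2]
  rw [Finset.sum_congr rfl fun a _ => h a, ← Finset.sum_smul, sum_px_mul_px]
  simp [blockDiag_apply]

theorem blockDiag_px_inl_smul_sub (f : ∀ i, Module.End ℂ (Q.vertexSpace M i)) (a : Q.A) (m : M) :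
    Q.blockDiag f (Q.px (.inl a) • m) - Q.px (.inl a) • Q.blockDiag f m =
      (Q.arrowDeriv M f).1 a (Q.vertexProj (Q.src a) m) := by
  have h1 : Q.px (.inl a) • Q.pe (Q.src a) • m = Q.px (.inl a) • m := Q.px_smul_pe_smul _ m
  have h2 : Q.px (.inl a) • Q.pe (Q.src a) • Q.blockDiag f m = Q.px (.inl a) • Q.blockDiag f m :=
    Q.px_smul_pe_smul _ _
  have h3 : Q.pe (Q.tgt a) • Q.px (.inl a) • m = Q.px (.inl a) • m :=
    Q.pe_smul_px_smul (.inl a) m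
  rw [← h3, blockDiag_pe_smul, ← h2, pe_smul_blockDiag]
  simp only [arrowDeriv, repDerivation, LinearMap.coe_mk, AddHom.coe_mk, LinearMap.sub_apply,
    LinearMap.comp_apply, AddSubgroupClass.coe_sub, coe_arrowMap]
  rw [show Q.vertexProj (Q.tgt a) (Q.px (.inl a) • m) =
    Q.arrowMap M a (Q.vertexProj (Q.src a) m) from Subtype.ext ?_]
  simp only [coe_vertexProj, coe_arrowMap, h1]
  exact h3

theorem blockDiag_px_inr_smul_sub (f : ∀ i, Module.End ℂ (Q.vertexSpace M i)) (a : Q.A) (m : M) :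
    Q.blockDiag f (Q.px (.inr a) • m) - Q.px (.inr a) • Q.blockDiag f m =
      (Q.arrowDeriv M f).2 a (Q.vertexProj (Q.tgt a) m) := by
  have h1 : Q.px (.inr a) • Q.pe (Q.tgt a) • m = Q.px (.inr a) • m := Q.px_smul_pe_smul _ m
  have h2 : Q.px (.inr a) • Q.pe (Q.tgt a) • Q.blockDiag f m = Q.px (.inr a) • Q.blockDiag f m :=
    Q.px_smul_pe_smul _ _
  have h3 : Q.pe (Q.src a) • Q.px (.inr a) • m = Q.px (.inr a) • m :=
    Q.pe_smul_px_smul (.inr a) m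
  rw [← h3, blockDiag_pe_smul, ← h2, pe_smul_blockDiag]
  simp only [arrowDeriv, repDerivation, LinearMap.coe_mk, AddHom.coe_mk, LinearMap.sub_apply,
    LinearMap.comp_apply, AddSubgroupClass.coe_sub, coe_arrowMapStar]
  rw [show Q.vertexProj (Q.src a) (Q.px (.inr a) • m) =
    Q.arrowMapStar M a (Q.vertexProj (Q.tgt a) m) from Subtype.ext ?_]
  simp only [coe_vertexProj, coe_arrowMapStar, h1]
  exact h3

variable {Q} in
/-- Two derivations into the endomorphisms of a module agree if they agree on generators. -/
theorem derivation_ext {D D' : Q.Preproj →ₗ[ℂ] Module.End ℂ M}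
    (hD : ∀ r r', D (r * r') = Q.act M r * D r' + D r * Q.act M r')
    (hD' : ∀ r r', D' (r * r') = Q.act M r * D' r' + D' r * Q.act M r')
    (hpe : ∀ i, D (Q.pe i) = D' (Q.pe i)) (hpx : ∀ a, D (Q.px a) = D' (Q.px a)) : D = D' := by
  refine LinearMap.ext fun r => preproj_induction (p := fun r => D r = D' r)
    (fun c => ?_) hpe hpx (fun r r' h h' => ?_)
    (fun r r' h h' => ?_) r
  · have h1 := hD 1 1
    have h1' := hD' 1 1
    rw [mul_one, map_one (Q.act M), one_mul, mul_one, left_eq_add] at h1 h1'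
    rw [Algebra.algebraMap_eq_smul_one, map_smul, map_smul, h1, h1']
  · rw [hD, hD', h, h']
  · rw [map_add, map_add, h, h']

/-- The inner derivation attached to an endomorphism of a module. -/
noncomputable def innerDerivation (F : Module.End ℂ M) : Q.Preproj →ₗ[ℂ] Module.End ℂ M where
  toFun r := Q.act M r * F - F * Q.act M r
  map_add' r r' := by rw [map_add]; noncomm_ring
  map_smul' c r := by rw [map_smul, smul_mul_assoc, mul_smul_comm, smul_sub, RingHom.id_apply]

theorem innerDerivation_mul (F : Module.End ℂ M) (r r' : Q.Preproj) :
    Q.innerDerivation F (r * r') =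
      Q.act M r * Q.innerDerivation F r' + Q.innerDerivation F r * Q.act M r' := by
  simp only [innerDerivation, LinearMap.coe_mk, AddHom.coe_mk, map_mul]
  noncomm_ring

theorem innerDerivation_apply (F : Module.End ℂ M) (r : Q.Preproj) (m : M) :
    Q.innerDerivation F r m = r • F m - F (r • m) := rfl

theorem blockDiag_smul_of_repDerivation_eq_zero (f : ∀ i, Module.End ℂ (Q.vertexSpace M i))
    (hf : Q.arrowDeriv M f = 0) (r : Q.Preproj) (m : M) :
    Q.blockDiag f (r • m) = r • Q.blockDiag f m := by
  have : Q.innerDerivation (Q.blockDiag f) = 0 := by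
    refine derivation_ext (Q.innerDerivation_mul _) (by simp) (fun i => ?_) (fun a => ?_)
    · ext m
      rw [innerDerivation_apply, pe_smul_blockDiag, blockDiag_pe_smul]
      simp
    · ext m
      rw [innerDerivation_apply, ← neg_sub]
      cases a with
      | inl a => rw [blockDiag_px_inl_smul_sub, hf]; simp
      | inr a => rw [blockDiag_px_inr_smul_sub, hf]; simp
  have h := congrArg (fun D => D r m) this
  rw [innerDerivation_apply] at h
  exact (sub_eq_zero.1 h).symm

/-- If the deformation complex of a module is exact in the middle, then every derivation into its
endomorphisms that vanishes on the vertex idempotents is inner. -/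
theorem exists_eq_innerDerivation
    (hexact : ∀ c, Q.momentDeriv M c = 0 →
      ∃ f, Q.arrowDeriv M f = c)
    (D : Q.Preproj →ₗ[ℂ] Module.End ℂ M)
    (hD : ∀ r r', D (r * r') = Q.act M r * D r' + D r * Q.act M r') (hpe : ∀ i, D (Q.pe i) = 0) :
    ∃ F, D = Q.innerDerivation F := by
  have hl (a : Q.DArrow) (m : M) : Q.pe (Q.dtgt a) • D (Q.px a) m = D (Q.px a) m := by
    conv_rhs => rw [← Q.pe_mul_px a, hD, hpe]
    simp
  have hr (a : Q.DArrow) (m : M) : D (Q.px a) (Q.pe (Q.dsrc a) • m) = D (Q.px a) m := by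
    conv_rhs => rw [← Q.px_mul_pe a, hD, hpe]
    simp
  obtain ⟨f, hf⟩ := hexact
    (fun a => Q.block (D (Q.px (.inl a))) _ _, fun a => Q.block (D (Q.px (.inr a))) _ _) <| by
    refine Q.blockDiag_injective (LinearMap.ext fun m => ?_)
    rw [momentDeriv, momentMapDeriv_apply, blockDiag_sum_single_sub]
    have h : Q.blockDiag 0 m = ∑ a : Q.A,
        D (Q.px (.inl a) * Q.px (.inr a) - Q.px (.inr a) * Q.px (.inl a)) m := by
      rw [← LinearMap.sum_apply, ← map_sum, sum_px_mul_px]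
      simp [blockDiag_apply]
    refine Eq.trans (Finset.sum_congr rfl fun a _ => ?_) h.symm
    have h1 := Q.px_smul_pe_smul (.inl a) m
    have h2 := Q.px_smul_pe_smul (.inr a) m
    have h3 := hl (.inl a)
    have h4 := hl (.inr a)
    have h5 := hr (.inl a) m
    have h6 := hr (.inr a) m
    simp only [dsrc, dtgt] at h1 h2 h3 h4 h5 h6
    simp only [LinearMap.add_apply, LinearMap.comp_apply, Submodule.coe_add, coe_block,
      coe_arrowMap, coe_arrowMapStar, coe_vertexProj, map_sub, hD, LinearMap.sub_apply,
      Module.End.mul_apply, Algebra.lsmul_coe, h1, h2, h3, h4, h5, h6]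
    abel
  refine ⟨-Q.blockDiag f, derivation_ext hD (Q.innerDerivation_mul _) (fun i => ?_) fun a => ?_⟩
  · ext m
    rw [innerDerivation_apply, hpe, LinearMap.neg_apply, LinearMap.neg_apply, smul_neg,
      pe_smul_blockDiag, blockDiag_pe_smul]
    simp
  · ext m
    rw [innerDerivation_apply, LinearMap.neg_apply, LinearMap.neg_apply, smul_neg, neg_sub_neg]
    cases a with
    | inl a =>
      rw [blockDiag_px_inl_smul_sub, hf, coe_block, coe_vertexProj]
      exact ((hl (.inl a) _).trans (hr (.inl a) m)).symm
    | inr a =>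
      rw [blockDiag_px_inr_smul_sub, hf, coe_block, coe_vertexProj]
      exact ((hl (.inr a) _).trans (hr (.inr a) m)).symm

/-- If every derivation into the endomorphisms of `M` that vanishes on the vertex idempotents is
inner, then homomorphisms to `M` extend from the kernel of a surjection onto `M`. -/
theorem exists_extension_of_ker
    (hinner : ∀ D : Q.Preproj →ₗ[ℂ] Module.End ℂ M,
      (∀ r r', D (r * r') = Q.act M r * D r' + D r * Q.act M r') → (∀ i, D (Q.pe i) = 0) →
      ∃ F, D = Q.innerDerivation F)
    {P : Type*} [AddCommGroup P] [Module ℂ P] [Module Q.Preproj P] [IsScalarTower ℂ Q.Preproj P]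
    (ε : P →ₗ[Q.Preproj] M) (hε : Function.Surjective ε)
    (g : LinearMap.ker ε →ₗ[Q.Preproj] M) :
    ∃ h : P →ₗ[Q.Preproj] M, ∀ k : LinearMap.ker ε, h k = g k := by
  obtain ⟨σ₀, hσ₀⟩ := (ε.restrictScalars ℂ).exists_rightInverse_of_surjective
    (LinearMap.range_eq_top.2 hε)
  have hσ₀' (m : M) : ε (σ₀ m) = m := LinearMap.congr_fun hσ₀ m
  let σ : M →ₗ[ℂ] P := ∑ i, Q.act P (Q.pe i) ∘ₗ σ₀ ∘ₗ Q.act M (Q.pe i)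
  have hσ (m : M) : σ m = ∑ i, Q.pe i • σ₀ (Q.pe i • m) := by simp [σ, LinearMap.sum_apply]
  have hεσ (m : M) : ε (σ m) = m := by
    simp [hσ, hσ₀', smul_smul, pe_mul_pe, ← Finset.sum_smul, sum_pe]
  have hσpe (i : Q.V) (m : M) : σ (Q.pe i • m) = Q.pe i • σ m := by
    simp only [hσ, Finset.smul_sum, smul_smul, pe_mul_pe]
    rw [Finset.sum_eq_single i (fun j _ hj => by simp [hj]) (by simp),
      Finset.sum_eq_single i (fun j _ hj => by simp [hj.symm]) (by simp)]
    simp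
  let κ : P →ₗ[ℂ] LinearMap.ker (ε.restrictScalars ℂ) :=
    (LinearMap.id - σ ∘ₗ ε.restrictScalars ℂ).codRestrict _ fun p => by simp [hεσ]
  let G : P →ₗ[ℂ] M := (g.restrictScalars ℂ) ∘ₗ κ
  have hG (p : P) (hp : p - σ (ε p) ∈ LinearMap.ker ε) : G p = g ⟨p - σ (ε p), hp⟩ := rfl
  have hGσ (m : M) : G (σ m) = 0 := by
    rw [hG _ (by simp [hεσ]), ← map_zero g]
    exact congrArg g (Subtype.ext (by simp [hεσ]))
  have hGsmul (r : Q.Preproj) (p : P) : G (r • p) = r • G p + G (r • σ (ε p)) := by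
    rw [hG (r • p) (by simp [hεσ]), hG p (by simp [hεσ]), hG (r • σ (ε p)) (by simp [hεσ]),
      ← map_smul g, ← map_add g]
    refine congrArg g (Subtype.ext ?_)
    simp [hεσ, smul_sub]
  let D : Q.Preproj →ₗ[ℂ] Module.End ℂ M :=
    { toFun := fun r => G ∘ₗ Q.act P r ∘ₗ σ
      map_add' := fun r r' => by ext m; simp
      map_smul' := fun c r => by ext m; simp }
  have hDapply (r : Q.Preproj) (m : M) : D r m = G (r • σ m) := rfl
  obtain ⟨F, hF⟩ := hinner D
    (fun r r' => by
      ext m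
      simp only [LinearMap.add_apply, Module.End.mul_apply, Algebra.lsmul_coe, hDapply, mul_smul]
      rw [hGsmul, map_smul ε, hεσ])
    (fun i => by
      ext m
      rw [hDapply, ← hσpe, hGσ, LinearMap.zero_apply])
  refine ⟨{ toFun := fun p => G p + F (ε p)
            map_add' := fun p q => by simp only [map_add]; abel
            map_smul' := fun r p => ?_ }, fun k => ?_⟩
  · have h := congrArg (fun D => D r (ε p)) hF
    simp only [hDapply, innerDerivation_apply] at h
    rw [hGsmul, h, map_smul ε, RingHom.id_apply, smul_add]
    abel
  · have hk : ε k = 0 := k.2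
    change G k + F (ε k) = g k
    rw [hk, map_zero, add_zero, hG _ (by simp [hk])]
    exact congrArg g (Subtype.ext (by simp [hk]))

end Modules

end LooplessQuiver

section Ext

attribute [local instance] ModuleCat.moduleOfAlgebraModule
  ModuleCat.isScalarTower_of_algebra_moduleCat

/-- `Ext¹(M, N)` vanishes if homomorphisms to `N` extend from kernels of surjections onto `M`. -/
theorem LooplessQuiver.ext1Vanishes_of_extension (Q : LooplessQuiver) (M N : ModuleCat.{0} Q.Preproj)
    (h : ∀ (P : ModuleCat.{0} Q.Preproj) (ε : P →ₗ[Q.Preproj] M), Function.Surjective ε →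
      ∀ g : LinearMap.ker ε →ₗ[Q.Preproj] N,
        ∃ g' : P →ₗ[Q.Preproj] N, ∀ k : LinearMap.ker ε, g' k = g k) :
    Q.Ext1Vanishes M N := by
  let P := projectiveResolution M
  refine ModuleCat.subsingleton_of_isZero (IsZero.of_iso ?_ (P.isoExt 1 N))
  rw [← HomologicalComplex.exactAt_iff_isZero_homology,
    HomologicalComplex.exactAt_iff' _ 0 1 2 (by simp) (by simp), ShortComplex.moduleCat_exact_iff]
  intro (f : P.complex.X 1 ⟶ N) (hf : P.complex.d 2 1 ≫ f = 0)
  let e : P.complex.X 0 ⟶ M := P.π.f 0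
  have hε : Function.Surjective e.hom := (ModuleCat.epi_iff_surjective (P.π.f 0)).1 inferInstance
  have hd : P.complex.d 1 0 ≫ e = 0 := P.complex_d_comp_π_f_zero
  let d : P.complex.X 1 →ₗ[Q.Preproj] LinearMap.ker e.hom :=
    (P.complex.d 1 0).hom.codRestrict _ fun y =>
      congrArg (fun φ : P.complex.X 1 ⟶ M => φ.hom y) hd
  have hdsurj : Function.Surjective d := by
    rintro ⟨p, hp⟩
    obtain ⟨y, hy⟩ := (ShortComplex.moduleCat_exact_iff _).1 P.exact₀ p hp
    exact ⟨y, Subtype.ext hy⟩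
  have hker : LinearMap.ker d ≤ LinearMap.ker f.hom := by
    intro y hy
    have hy' : P.complex.d 1 0 y = 0 := congrArg Subtype.val hy
    obtain ⟨z, hz⟩ := (ShortComplex.moduleCat_exact_iff _).1 (P.exact_succ 0) y hy'
    rw [LinearMap.mem_ker, ← hz]
    exact congrArg (fun φ : P.complex.X 2 ⟶ N => φ.hom z) hf
  obtain ⟨g', hg'⟩ := h _ e.hom hε
    ((LinearMap.ker d).liftQ f.hom hker ∘ₗ (d.quotKerEquivOfSurjective hdsurj).symm.toLinearMap)
  refine ⟨ModuleCat.ofHom g', ?_⟩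
  change P.complex.d 1 0 ≫ ModuleCat.ofHom g' = f
  ext y
  have h1 : (d.quotKerEquivOfSurjective hdsurj).symm (d y) = (LinearMap.ker d).mkQ y := by
    rw [LinearEquiv.symm_apply_eq]
    rfl
  have h2 := hg' (d y)
  rw [LinearMap.comp_apply, LinearEquiv.coe_coe, h1] at h2
  exact h2

end Ext

/-- Let `Q` be a Dynkin quiver and `M` a brick in `P(Q)-mod`.
Then `Ext¹(M, M) = 0` and the dimension vector of `M` is a root,
i.e. `(dim M, dim M) = 2`. -/
theorem brick_is_rigid_and_dim_is_root
    (Q : LooplessQuiver) (hQ : Q.IsDynkin)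
    (M : ModuleCat.{0} Q.Preproj) (hfd : Q.FinDim M) (hM : Q.IsBrick M) :
    Q.Ext1Vanishes M M ∧ Q.form (Q.dimVec M) (Q.dimVec M) = 2 := by
  let := ModuleCat.moduleOfAlgebraModule (k := ℂ) M
  have := ModuleCat.isScalarTower_of_algebra_moduleCat (k := ℂ) M
  have : FiniteDimensional ℂ M := hfd
  obtain ⟨⟨m, hm⟩, hend⟩ := hM
  have hdim (i : Q.V) : Q.dimAt M i = Module.finrank ℂ (Q.vertexSpace M i) := by
    rw [LooplessQuiver.dimAt]
    exact congrArg (fun W : Submodule ℂ M => Module.finrank ℂ W)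
      (Submodule.span_eq (Q.vertexSpace M i))
  have hform : Q.form (Q.dimVec M) (Q.dimVec M) =
      2 * ((∑ i, Module.finrank ℂ (Q.vertexSpace M i) ^ 2 : ℕ) -
        (∑ a, Module.finrank ℂ (Q.vertexSpace M (Q.src a)) *
          Module.finrank ℂ (Q.vertexSpace M (Q.tgt a)) : ℕ) : ℤ) := by
    simp only [LooplessQuiver.form, LooplessQuiver.dimVec, hdim]
    push_cast
    simp only [Finset.sum_add_distrib, mul_comm (Module.finrank ℂ (Q.vertexSpace M (Q.tgt _)) : ℤ),
      sq]
    ring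
  have hne : Q.dimVec M ≠ 0 := by
    intro h0
    refine hm ?_
    rw [← one_smul Q.Preproj m, ← Q.sum_pe, Finset.sum_smul]
    refine Finset.sum_eq_zero fun i _ => ?_
    have hi : Module.finrank ℂ (Q.vertexSpace M i) = 0 := by
      rw [← hdim]
      exact Int.natCast_eq_zero.1 (congrFun h0 i)
    have := Module.finrank_zero_iff.1 hi
    exact congrArg Subtype.val (Subsingleton.elim (Q.vertexProj i m) 0)
  have hpos := hQ _ hne
  rw [hform] at hpos ⊢
  obtain ⟨h1, hexact⟩ := exists_repDerivation_eq_of_momentMapDeriv_eq_zero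
    (V := fun i => Q.vertexSpace M i) (Q.arrowMap M) (Q.arrowMapStar M) (Q.momentMap_arrowMap M)
    (fun f hf => by
      obtain ⟨c, hc⟩ := hend (ModuleCat.ofHom
        { toFun := Q.blockDiag f
          map_add' := map_add _
          map_smul' := Q.blockDiag_smul_of_repDerivation_eq_zero f hf })
      refine ⟨c, ?_⟩
      ext i v
      have h2 : Q.pe i • Q.blockDiag f (v : M) = f i v := by
        rw [Q.pe_smul_blockDiag]
        congr 2
        exact Subtype.ext (Q.pe_smul_coe i v)
      have h3 : Q.blockDiag f (v : M) = c • (v : M) := by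
        rw [← algebraMap_smul Q.Preproj c (v : M)]
        exact hc v
      rw [← h2, h3, smul_comm, Q.pe_smul_coe]
      rfl)
    (by omega)
  refine ⟨Q.ext1Vanishes_of_extension M M fun P ε hε g => ?_, by rw [h1]; push_cast; ring⟩
  let := ModuleCat.moduleOfAlgebraModule (k := ℂ) P
  have := ModuleCat.isScalarTower_of_algebra_moduleCat (k := ℂ) P
  exact Q.exists_extension_of_ker (Q.exists_eq_innerDerivation hexact) ε hε g

end GreenSeqPaper
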